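/- Every stable classical solution u of Δ²u = u^p, u > 0, on ℝⁿ with p > 1 satisfies: there exists a constant C > 0 such that for all R ≥ 1, ∫_{B_{2R}} u² dx ≤ C R^{n − 8/(p−1)}, where B_{2R} is the ball of radius 2R centered at the origin. -/

import Mathlib

open MeasureTheory Real RealInnerProductSpace

/-- The Laplacian of `f : ℝⁿ → ℝ`, as the trace of the second derivative. -/
noncomputable def lap {n : ℕ} (f : EuclideanSpace ℝ (Fin n) → ℝ)
    (x : EuclideanSpace ℝ (Fin n)) : ℝ :=
  ∑ i : Fin n,
    iteratedFDeriv ℝ 2 f x ![EuclideanSpace.single i 1, EuclideanSpace.single i 1]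

/-- Squared Frobenius norm of the Hessian of `f : ℝⁿ → ℝ`. -/
noncomputable def hessNormSq {n : ℕ} (f : EuclideanSpace ℝ (Fin n) → ℝ)
    (x : EuclideanSpace ℝ (Fin n)) : ℝ :=
  ∑ i : Fin n, ∑ j : Fin n,
    (iteratedFDeriv ℝ 2 f x ![EuclideanSpace.single i 1, EuclideanSpace.single j 1]) ^ 2

/-- The quantity `‖∇⁴(φ^{2γ})‖` defined by
`‖∇⁴(φ^{2γ})‖² = φ^{-2γ}|∇φ^γ|⁴ + |φ^γ Δ²φ^γ| + |∇²φ^γ|²`,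
with the first term interpreted as `0` where `φ = 0`. -/
noncomputable def norm4 {n : ℕ} (γ : ℝ) (φ : EuclideanSpace ℝ (Fin n) → ℝ)
    (x : EuclideanSpace ℝ (Fin n)) : ℝ :=
  Real.sqrt
    ((if φ x = 0 then 0 else φ x ^ (-(2*γ)) * ‖gradient (fun y => φ y ^ γ) x‖ ^ 4)
      + |φ x ^ γ * lap (lap (fun y => φ y ^ γ)) x|
      + hessNormSq (fun y => φ y ^ γ) x)

/-- The `i`-th partial derivative of `f : ℝⁿ → ℝ`. -/
noncomputable def pd {n : ℕ} (i : Fin n) (f : EuclideanSpace ℝ (Fin n) → ℝ)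
    (x : EuclideanSpace ℝ (Fin n)) : ℝ :=
  fderiv ℝ f x (EuclideanSpace.single i 1)

section PartialDerivatives

variable {n : ℕ} {i : Fin n} {f g : EuclideanSpace ℝ (Fin n) → ℝ}

lemma pd_contDiff {k m : WithTop ℕ∞} (hf : ContDiff ℝ m f) (hk : k + 1 ≤ m) :
    ContDiff ℝ k (pd i f) :=
  (hf.fderiv_right hk).clm_apply contDiff_const

lemma pd_hasCompactSupport (hf : HasCompactSupport f) : HasCompactSupport (pd i f) :=
  hf.fderiv_apply ℝ _

lemma pd_add (hf : Differentiable ℝ f) (hg : Differentiable ℝ g) :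
    pd i (fun x => f x + g x) = fun x => pd i f x + pd i g x := by
  funext x
  simp [pd, fderiv_fun_add (hf x) (hg x)]

lemma pd_sub (hf : Differentiable ℝ f) (hg : Differentiable ℝ g) :
    pd i (fun x => f x - g x) = fun x => pd i f x - pd i g x := by
  funext x
  simp [pd, fderiv_fun_sub (hf x) (hg x)]

lemma pd_mul (hf : Differentiable ℝ f) (hg : Differentiable ℝ g) :
    pd i (fun x => f x * g x) = fun x => f x * pd i g x + g x * pd i f x := by
  funext x
  simp [pd, fderiv_fun_mul (hf x) (hg x)]

lemma pd_const_mul (c : ℝ) (hf : Differentiable ℝ f) :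
    pd i (fun x => c * f x) = fun x => c * pd i f x := by
  funext x
  simp [pd, fderiv_const_mul (hf x)]

lemma pd_pow (k : ℕ) (hf : Differentiable ℝ f) :
    pd i (fun x => f x ^ (k + 1)) = fun x => (k + 1) * f x ^ k * pd i f x := by
  funext x
  simp [pd, fderiv_fun_pow (k + 1) (hf x)]

lemma pd_comp_smul (c : ℝ) (f : EuclideanSpace ℝ (Fin n) → ℝ) :
    pd i (fun x => f (c • x)) = fun x => c * pd i f (c • x) := by
  funext x
  simp [pd, fderiv_comp_smul]

lemma lap_eq_sum_pd (hf : ContDiff ℝ 2 f) : lap f = fun x => ∑ i, pd i (pd i f) x := by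
  funext x
  refine Finset.sum_congr rfl fun i _ => ?_
  have h : DifferentiableAt ℝ (fderiv ℝ f) x :=
    ((hf.fderiv_right (m := 1) le_rfl).differentiable one_ne_zero) x
  change _ = fderiv ℝ (fun y => fderiv ℝ f y _) x _
  rw [iteratedFDeriv_two_apply, fderiv_clm_apply h (differentiableAt_const _)]
  simp

lemma lap_contDiff {k m : WithTop ℕ∞} (hf : ContDiff ℝ m f) (hk : k + 2 ≤ m) :
    ContDiff ℝ k (lap f) := by
  rw [lap_eq_sum_pd (hf.of_le (le_trans le_add_self hk))]
  refine ContDiff.sum fun i _ => ?_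
  refine pd_contDiff (m := k + 1) (pd_contDiff hf ?_) le_rfl
  rwa [add_assoc, one_add_one_eq_two]

lemma lap_hasCompactSupport (h : ContDiff ℝ 2 f) (hf : HasCompactSupport f) :
    HasCompactSupport (lap f) := by
  refine hf.mono' ?_
  intro x hx
  by_contra hxt
  apply hx
  rw [lap_eq_sum_pd h]
  refine Finset.sum_eq_zero fun i _ => ?_
  have h1 : x ∉ tsupport (pd i f) := fun hx' =>
    hxt (tsupport_fderiv_apply_subset ℝ _ hx')
  have h2 : x ∉ tsupport (pd i (pd i f)) := fun hx' =>
    h1 (tsupport_fderiv_apply_subset ℝ _ hx')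
  exact image_eq_zero_of_notMem_tsupport h2

lemma lap_mul (hf : ContDiff ℝ 2 f) (hg : ContDiff ℝ 2 g) :
    lap (fun x => f x * g x) =
      fun x => f x * lap g x + 2 * ∑ i, pd i f x * pd i g x + g x * lap f x := by
  have hf0 := hf.differentiable two_ne_zero
  have hg0 := hg.differentiable two_ne_zero
  have hf1 (i) : Differentiable ℝ (pd i f) :=
    (pd_contDiff (k := 1) hf (by norm_num)).differentiable one_ne_zero
  have hg1 (i) : Differentiable ℝ (pd i g) :=
    (pd_contDiff (k := 1) hg (by norm_num)).differentiable one_ne_zero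
  rw [lap_eq_sum_pd (hf.mul hg), lap_eq_sum_pd hf, lap_eq_sum_pd hg]
  funext x
  rw [Finset.mul_sum, Finset.mul_sum, Finset.mul_sum, ← Finset.sum_add_distrib,
    ← Finset.sum_add_distrib]
  refine Finset.sum_congr rfl fun i _ => ?_
  rw [pd_mul hf0 hg0, pd_add (hf0.fun_mul (hg1 i)) (hg0.fun_mul (hf1 i)), pd_mul hf0 (hg1 i),
    pd_mul hg0 (hf1 i)]
  ring

lemma lap_pow (k : ℕ) (hf : ContDiff ℝ 2 f) :
    lap (fun x => f x ^ (k + 2)) =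
      fun x => (k + 2) * (k + 1) * f x ^ k * ∑ i, pd i f x ^ 2
        + (k + 2) * f x ^ (k + 1) * lap f x := by
  have hf0 := hf.differentiable two_ne_zero
  have hf1 (i) : Differentiable ℝ (pd i f) :=
    (pd_contDiff (k := 1) hf (by norm_num)).differentiable one_ne_zero
  rw [lap_eq_sum_pd (hf.pow _), lap_eq_sum_pd hf]
  funext x
  rw [Finset.mul_sum, Finset.mul_sum, ← Finset.sum_add_distrib]
  refine Finset.sum_congr rfl fun i _ => ?_
  rw [pd_pow (k + 1) hf0, pd_mul ((hf0.fun_pow _).const_mul _) (hf1 i),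
    pd_const_mul _ (hf0.fun_pow _), pd_pow k hf0]
  push_cast
  ring

lemma integral_pd_eq_zero (hf : ContDiff ℝ 1 f) (hc : HasCompactSupport f) :
    ∫ x, pd i f x = 0 := by
  have hi : Integrable (pd i f) :=
    (pd_contDiff (k := 0) hf (by norm_num)).continuous.integrable_of_hasCompactSupport
      (pd_hasCompactSupport hc)
  have := integral_mul_fderiv_eq_neg_fderiv_mul_of_integrable (μ := volume) (𝕜 := ℝ)
    (f := fun _ => 1) (g := f) (v := EuclideanSpace.single i 1) (by simp)
    (by simp only [one_mul]; exact hi)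
    (by simpa using hf.continuous.integrable_of_hasCompactSupport hc)
    (by simp) (fun x _ => (hf.differentiable one_ne_zero) x)
  simpa [pd] using this

lemma integral_lap_mul (hf : ContDiff ℝ 2 f) (hg : ContDiff ℝ 2 g) (hc : HasCompactSupport g) :
    ∫ x, lap f x * g x = ∫ x, f x * lap g x := by
  have hf0 := hf.differentiable two_ne_zero
  have hg0 := hg.differentiable two_ne_zero
  have hf1 (i) : ContDiff ℝ 1 (pd i f) := pd_contDiff hf (by norm_num)
  have hg1 (i) : ContDiff ℝ 1 (pd i g) := pd_contDiff hg (by norm_num)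
  have hF (i) : ContDiff ℝ 1 (fun x => pd i f x * g x - f x * pd i g x) :=
    ((hf1 i).mul (hg.of_le one_le_two)).sub ((hf.of_le one_le_two).mul (hg1 i))
  have hFc (i) : HasCompactSupport (fun x => pd i f x * g x - f x * pd i g x) :=
    hc.mul_left.sub (pd_hasCompactSupport hc).mul_left
  have key : ∫ x, ∑ i, pd i (fun x => pd i f x * g x - f x * pd i g x) x = 0 := by
    rw [integral_finsetSum]
    · exact Finset.sum_eq_zero fun i _ => integral_pd_eq_zero (hF i) (hFc i)
    · intro i _
      exact (pd_contDiff (k := 0) (hF i) (by norm_num)).continuous.integrable_of_hasCompactSupport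
        (pd_hasCompactSupport (hFc i))
  have h1 : Integrable (fun x => lap f x * g x) :=
    ((lap_contDiff (k := 0) hf (by norm_num)).continuous.mul
      hg.continuous).integrable_of_hasCompactSupport hc.mul_left
  have h2 : Integrable (fun x => f x * lap g x) :=
    (hf.continuous.mul (lap_contDiff (k := 0) hg
      (by norm_num)).continuous).integrable_of_hasCompactSupport
      (lap_hasCompactSupport hg hc).mul_left
  rw [← sub_eq_zero, ← integral_sub h1 h2, ← key]
  congr 1
  funext x
  rw [lap_eq_sum_pd hf, lap_eq_sum_pd hg, Finset.sum_mul, Finset.mul_sum,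
    ← Finset.sum_sub_distrib]
  refine Finset.sum_congr rfl fun i _ => ?_
  have hf1' := (hf1 i).differentiable one_ne_zero
  have hg1' := (hg1 i).differentiable one_ne_zero
  rw [pd_sub (hf1'.fun_mul hg0) (hf0.fun_mul hg1'), pd_mul hf1' hg0, pd_mul hf0 hg1']
  ring

end PartialDerivatives

section Mollification

open scoped Convolution Topology

open ContinuousLinearMap (lsmul)

variable {n : ℕ} {f : EuclideanSpace ℝ (Fin n) → ℝ}

lemma normed_locallyIntegrable (ρ : ContDiffBump (0 : EuclideanSpace ℝ (Fin n))) :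
    LocallyIntegrable (ρ.normed volume) :=
  ρ.continuous_normed.locallyIntegrable

lemma pd_convolution (ρ : ContDiffBump (0 : EuclideanSpace ℝ (Fin n))) (i : Fin n)
    (hf : ContDiff ℝ 1 f) (hc : HasCompactSupport f) :
    pd i (ρ.normed volume ⋆[lsmul ℝ ℝ] f) = ρ.normed volume ⋆[lsmul ℝ ℝ] pd i f := by
  funext x
  unfold pd
  rw [(hc.hasFDerivAt_convolution_right (lsmul ℝ ℝ) (normed_locallyIntegrable ρ) hf x).fderiv,
    convolution_precompR_apply _ (normed_locallyIntegrable ρ) (hc.fderiv ℝ)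
      (hf.continuous_fderiv one_ne_zero)]

lemma convolution_contDiff (ρ : ContDiffBump (0 : EuclideanSpace ℝ (Fin n)))
    (hf : Continuous f) :
    ContDiff ℝ (⊤ : ℕ∞) (ρ.normed volume ⋆[lsmul ℝ ℝ] f) :=
  ρ.hasCompactSupport_normed.contDiff_convolution_left (lsmul ℝ ℝ) ρ.contDiff_normed
    hf.locallyIntegrable

lemma lap_convolution (ρ : ContDiffBump (0 : EuclideanSpace ℝ (Fin n)))
    (hf : ContDiff ℝ 2 f) (hc : HasCompactSupport f) :
    lap (ρ.normed volume ⋆[lsmul ℝ ℝ] f) = ρ.normed volume ⋆[lsmul ℝ ℝ] lap f := by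
  have hf1 (i) : ContDiff ℝ 1 (pd i f) := pd_contDiff hf (by norm_num)
  have hf2 (i) : ContDiff ℝ 0 (pd i (pd i f)) := pd_contDiff (hf1 i) (by norm_num)
  have hex (i) (x) : ConvolutionExistsAt (ρ.normed volume) (pd i (pd i f)) x (lsmul ℝ ℝ) :=
    (pd_hasCompactSupport (pd_hasCompactSupport hc)).convolutionExists_right _
      (normed_locallyIntegrable ρ) (hf2 i).continuous x
  rw [lap_eq_sum_pd ((convolution_contDiff ρ hf.continuous).of_le
      (WithTop.coe_le_coe.2 (le_top : (2 : ℕ∞) ≤ ⊤))),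
    lap_eq_sum_pd hf]
  funext x
  simp only [pd_convolution ρ _ (hf.of_le one_le_two) hc,
    pd_convolution ρ _ (hf1 _) (pd_hasCompactSupport hc)]
  simp only [convolution_def, map_sum]
  rw [integral_finsetSum _ fun i _ => hex i x]

lemma exists_convolution_bound (hf : Continuous f) (hc : HasCompactSupport f) :
    ∃ M r : ℝ, ∀ ρ : ContDiffBump (0 : EuclideanSpace ℝ (Fin n)), ρ.rOut ≤ 1 → ∀ x,
      ((ρ.normed volume ⋆[lsmul ℝ ℝ] f) x) ^ 2 ≤ (Metric.closedBall 0 r).indicator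
        (fun _ => M) x := by
  obtain ⟨C, hC⟩ := hc.exists_bound_of_continuous hf
  obtain ⟨r, hr⟩ := hc.isCompact.isBounded.subset_closedBall (0 : EuclideanSpace ℝ (Fin n))
  refine ⟨(3 * C) ^ 2, r + 1, fun ρ hρ x => ?_⟩
  by_cases hx : x ∈ Metric.closedBall (0 : EuclideanSpace ℝ (Fin n)) (r + 1)
  · rw [Set.indicator_of_mem hx]
    have h := ρ.dist_normed_convolution_le (μ := volume) (x₀ := x) (ε := 2 * C)
      hf.aestronglyMeasurable fun y _ => by
        have h1 := hC x
        have h2 := hC y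
        have h3 := dist_le_norm_add_norm (f y) (f x)
        linarith
    have h1 := hC x
    rw [Real.dist_eq, abs_le] at h
    rw [Real.norm_eq_abs, abs_le] at h1
    apply sq_le_sq' <;> linarith
  · rw [Set.indicator_of_notMem hx]
    have : (ρ.normed volume ⋆[lsmul ℝ ℝ] f) x = 0 := by
      by_contra h
      have hs := support_convolution_subset (μ := volume) (lsmul ℝ ℝ) (f := ρ.normed volume)
        (g := f) (Function.mem_support.2 h)
      rw [ρ.support_normed_eq] at hs
      obtain ⟨y, hy, z, hz, rfl⟩ := hs
      apply hx
      have hz' := hr (subset_tsupport f hz)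
      simp only [mem_closedBall_zero_iff, mem_ball_zero_iff] at *
      exact (norm_add_le y z).trans (by linarith)
    simp [this]

lemma tendsto_integral_mul_convolution_sq {w : EuclideanSpace ℝ (Fin n) → ℝ}
    (hw : Continuous w) (hf : Continuous f) (hc : HasCompactSupport f)
    {ρ : ℕ → ContDiffBump (0 : EuclideanSpace ℝ (Fin n))} (hρ : ∀ k, (ρ k).rOut ≤ 1)
    (hlim : Filter.Tendsto (fun k => (ρ k).rOut) Filter.atTop (𝓝 0)) :
    Filter.Tendsto
      (fun k => ∫ x, w x * (((ρ k).normed volume ⋆[lsmul ℝ ℝ] f) x) ^ 2) Filter.atTop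
      (𝓝 (∫ x, w x * f x ^ 2)) := by
  obtain ⟨M, r, hM⟩ := exists_convolution_bound hf hc
  refine tendsto_integral_of_dominated_convergence
    (fun x => (Metric.closedBall 0 r).indicator (fun x => |w x| * M) x) (fun k => ?_) ?_
    (fun k => ?_) ?_
  · exact (hw.mul ((convolution_contDiff (ρ k) hf).continuous.pow 2)).aestronglyMeasurable
  · rw [integrable_indicator_iff measurableSet_closedBall]
    exact (hw.abs.mul continuous_const).continuousOn.integrableOn_compact
      (isCompact_closedBall _ _)
  · refine Filter.Eventually.of_forall fun x => ?_
    rw [norm_mul, Real.norm_eq_abs, Real.norm_eq_abs, abs_sq]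
    refine (mul_le_mul_of_nonneg_left (hM (ρ k) (hρ k) x) (abs_nonneg _)).trans_eq ?_
    by_cases hx : x ∈ Metric.closedBall (0 : EuclideanSpace ℝ (Fin n)) r <;> simp [hx]
  · refine Filter.Eventually.of_forall fun x => ?_
    exact ((ContDiffBump.convolution_tendsto_right_of_continuous hlim hf x).pow 2).const_mul _

/-- Stability against smooth test functions implies stability against `C²` test functions. -/
lemma stability_of_contDiff_two {w : EuclideanSpace ℝ (Fin n) → ℝ} {p : ℝ} (hw : Continuous w)
    (hstab : ∀ φ : EuclideanSpace ℝ (Fin n) → ℝ, ContDiff ℝ (⊤ : ℕ∞) φ →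
      HasCompactSupport φ → p * ∫ x, w x * φ x ^ 2 ≤ ∫ x, (lap φ x) ^ 2)
    (hf : ContDiff ℝ 2 f) (hc : HasCompactSupport f) :
    p * ∫ x, w x * f x ^ 2 ≤ ∫ x, (lap f x) ^ 2 := by
  obtain ⟨ρ, hle, hlim⟩ : ∃ ρ : ℕ → ContDiffBump (0 : EuclideanSpace ℝ (Fin n)),
      (∀ k, (ρ k).rOut ≤ 1) ∧ Filter.Tendsto (fun k => (ρ k).rOut) Filter.atTop (𝓝 0) := by
    refine ⟨fun k => ⟨1 / ((k : ℝ) + 1) / 2, 1 / ((k : ℝ) + 1), by positivity,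
      half_lt_self (by positivity)⟩, fun k => ?_, tendsto_one_div_add_atTop_nhds_zero_nat⟩
    rw [div_le_one (by positivity)]
    linarith [(Nat.cast_nonneg k : (0 : ℝ) ≤ k)]
  have h1 := (tendsto_integral_mul_convolution_sq hw hf.continuous hc hle hlim).const_mul p
  have h2 := tendsto_integral_mul_convolution_sq (w := fun _ => 1) continuous_const
    (lap_contDiff (k := 0) hf (by norm_num)).continuous (lap_hasCompactSupport hf hc) hle hlim
  simp only [one_mul] at h2
  refine le_of_tendsto_of_tendsto' h1 h2 fun k => ?_
  have hk : HasCompactSupport ((ρ k).normed volume ⋆[lsmul ℝ ℝ] f) :=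
    (ρ k).hasCompactSupport_normed.convolution (lsmul ℝ ℝ) hc
  have := hstab _ (convolution_contDiff (ρ k) hf.continuous) hk
  rw [lap_convolution (ρ k) hf hc] at this
  exact this

end Mollification

section RealInequalities

lemma mul_sq_mul_pow_le_add_rpow {p q v t : ℝ} {k : ℕ} (hp : 1 < p) (hq : 0 < q) (hv : 0 < v)
    (ht : 0 ≤ t) (ht1 : t ≤ 1) (hk : 4 / (p - 1) ≤ k) :
    q * (v * t ^ k) ^ 2 ≤ v ^ (p - 1) * (v * t ^ (k + 2)) ^ 2 + q ^ ((p + 1) / (p - 1)) := by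
  have hp' : 0 < p - 1 := by linarith
  have hvp : 0 < v ^ (p - 1) := rpow_pos_of_pos hv _
  have hqp : 0 < q ^ ((p + 1) / (p - 1)) := rpow_pos_of_pos hq _
  rcases le_total q (v ^ (p - 1) * t ^ 4) with h | h
  · have := mul_le_mul_of_nonneg_right h (sq_nonneg (v * t ^ k))
    have e : v ^ (p - 1) * (v * t ^ (k + 2)) ^ 2 = v ^ (p - 1) * t ^ 4 * (v * t ^ k) ^ 2 := by ring
    linarith
  · have h1 : (v ^ (p - 1) * t ^ 4) ^ (2 / (p - 1)) ≤ q ^ (2 / (p - 1)) :=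
      rpow_le_rpow (by positivity) h (by positivity)
    rw [mul_rpow hvp.le (by positivity), ← rpow_mul hv.le, mul_div_cancel₀ _ hp'.ne',
      ← rpow_natCast t 4, ← rpow_mul ht] at h1
    have h2 : t ^ ((2 * k : ℕ) : ℝ) ≤ t ^ (((4 : ℕ) : ℝ) * (2 / (p - 1))) := by
      refine rpow_le_rpow_of_exponent_ge' ht ht1 (by positivity) ?_
      have e : ((4 : ℕ) : ℝ) * (2 / (p - 1)) = 2 * (4 / (p - 1)) := by push_cast; ring
      rw [e]
      push_cast
      linarith
    rw [rpow_natCast] at h2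
    have h3 : (v * t ^ k) ^ 2 ≤ q ^ (2 / (p - 1)) := by
      refine le_trans ?_ h1
      rw [rpow_two, mul_pow, ← pow_mul, mul_comm k 2]
      gcongr
    have e : q ^ ((p + 1) / (p - 1)) = q * q ^ (2 / (p - 1)) := by
      rw [← rpow_one_add' hq.le (by positivity)]
      congr 1
      field_simp
      ring
    have h4 := mul_le_mul_of_nonneg_left h3 hq.le
    have : 0 ≤ v ^ (p - 1) * (v * t ^ (k + 2)) ^ 2 := by positivity
    linarith

lemma sq_sub_two_mul_le {B T Q P a b c ε : ℝ} (hε : 0 < ε)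
    (hT : T ^ 2 ≤ B * b) (hQ : |Q| ≤ B * c) (hP : |P| ≤ B * (|a| * c)) :
    (2 * T + Q) ^ 2 - 2 * P ≤ ε * a ^ 2 + 8 * B * b + (2 * B ^ 2 + B ^ 2 / ε) * c ^ 2 := by
  have hQ2 : Q ^ 2 ≤ (B * c) ^ 2 := sq_le_sq.2 (hQ.trans (le_abs_self _))
  have h1 : 2 * (B * (|a| * c)) ≤ ε * a ^ 2 + B ^ 2 / ε * c ^ 2 := by
    have h : 0 ≤ (ε * |a| - B * c) ^ 2 / ε := by positivity
    have e : (ε * |a| - B * c) ^ 2 / ε =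
        ε * |a| ^ 2 + B ^ 2 / ε * c ^ 2 - 2 * (B * (|a| * c)) := by
      field_simp
      ring
    rw [e, sq_abs] at h
    linarith
  nlinarith [sq_nonneg (2 * T - Q), neg_abs_le P]

lemma half_sq_sub_le {B T Q P a b c : ℝ}
    (hT : T ^ 2 ≤ B * b) (hQ : |Q| ≤ B * c) (hP : |P| ≤ B * (|a| * c)) :
    1 / 2 * a ^ 2 + -(32 * B) * b + -(16 * B ^ 2) * c ^ 2 ≤
      a ^ 2 + 4 * a * T + 2 * a * Q + 2 * P := by
  have hQ2 : Q ^ 2 ≤ (B * c) ^ 2 := sq_le_sq.2 (hQ.trans (le_abs_self _))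
  have h1 := sq_nonneg (|a| - 8 * (B * c))
  rw [sub_sq, sq_abs] at h1
  nlinarith [sq_nonneg (a + 16 * T), sq_nonneg (a + 8 * Q), neg_abs_le P]

lemma half_sub_le {B V a b c ε : ℝ} (hε : 0 < ε) (hB : 0 < B) (hV : V ^ 2 ≤ 4 * B * b) :
    -ε * a ^ 2 + 1 / 2 * b + -(1 / (4 * ε) + 2 * B) * c ^ 2 ≤ b + a * c + c * V := by
  have h1 : 0 ≤ ε * a ^ 2 + 1 / (4 * ε) * c ^ 2 + a * c := by
    have h : 0 ≤ (2 * ε * a + c) ^ 2 / (4 * ε) := by positivity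
    have e : (2 * ε * a + c) ^ 2 / (4 * ε) = ε * a ^ 2 + 1 / (4 * ε) * c ^ 2 + a * c := by
      field_simp
      ring
    rwa [e] at h
  have h2 : 0 ≤ 1 / 2 * b + 2 * B * c ^ 2 + c * V := by
    have h : 0 ≤ (4 * B * c + V) ^ 2 / (8 * B) := by positivity
    have e : (4 * B * c + V) ^ 2 / (8 * B) = V ^ 2 / (8 * B) + 2 * B * c ^ 2 + c * V := by
      field_simp
      ring
    have h' : V ^ 2 / (8 * B) ≤ 1 / 2 * b := by
      rw [div_le_iff₀ (by positivity)]
      linarith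
    linarith
  linarith

/-- Absorption of the second-order and gradient energies `a`, `b` in the energy estimate. -/
lemma exists_energy_absorption {p B : ℝ} (hp : 1 < p) (hB : 0 < B) :
    ∃ K : ℝ, 0 < K ∧ ∀ X a b c : ℝ, 0 ≤ a → 0 ≤ c →
      (∀ ε, 0 < ε → (p - 1) * X ≤ ε * a + 8 * B * b + (2 * B ^ 2 + B ^ 2 / ε) * c) →
      (1 / 2 * a + -(32 * B) * b + -(16 * B ^ 2) * c ≤ X) →
      (∀ ε, 0 < ε → -ε * a + 1 / 2 * b + -(1 / (4 * ε) + 2 * B) * c ≤ 0) →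
      X ≤ K * c := by
  have hp' : 0 < p - 1 := by linarith
  obtain ⟨ε, hε, h1, h2⟩ : ∃ ε : ℝ, 0 < ε ∧ 256 * B * ε ≤ 1 ∧ (128 * B + 8) * ε ≤ p - 1 := by
    refine ⟨min (1 / (256 * B)) ((p - 1) / (128 * B + 8)), by positivity, ?_, ?_⟩
    · have := min_le_left (1 / (256 * B)) ((p - 1) / (128 * B + 8))
      rw [le_div_iff₀ (by positivity)] at this
      linarith
    · have := min_le_right (1 / (256 * B)) ((p - 1) / (128 * B + 8))
      rw [le_div_iff₀ (by positivity)] at this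
      linarith
  set D := 1 / (2 * ε) + 4 * B with hD
  have hD0 : 0 < D := by positivity
  set E := 64 * B * D + 32 * B ^ 2 with hE
  set F := 8 * B * D + (2 * B ^ 2 + B ^ 2 / ε) + (16 * B + 1) * ε * (2 * E) with hF
  refine ⟨2 * F / (p - 1), by positivity, fun X a b c ha hc hX hA hG => ?_⟩
  have hb : b ≤ 2 * ε * a + D * c := by
    have := hG ε hε
    have e : D = 2 * (1 / (4 * ε) + 2 * B) := by
      rw [hD]
      field_simp
      ring
    rw [e]
    linarith
  have hBb := mul_le_mul_of_nonneg_left hb hB.le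
  have ha' : a ≤ 4 * X + 2 * E * c := by
    have := mul_le_mul_of_nonneg_right h1 ha
    rw [hE]
    linarith
  have hX' : (p - 1) * X ≤ (16 * B + 1) * ε * a
      + (8 * B * D + (2 * B ^ 2 + B ^ 2 / ε)) * c := by
    have := hX ε hε
    linarith
  have h3 : (16 * B + 1) * ε * a ≤ (16 * B + 1) * ε * (4 * X + 2 * E * c) :=
    mul_le_mul_of_nonneg_left ha' (by positivity)
  rw [div_mul_eq_mul_div, le_div_iff₀ hp']
  rcases le_total X 0 with hX0 | hX0
  · have : 0 ≤ 2 * F * c := by positivity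
    nlinarith
  · have := mul_le_mul_of_nonneg_right h2 hX0
    rw [hF]
    linarith

end RealInequalities

section EnergyEstimate

variable {n : ℕ} {f g h u φ : EuclideanSpace ℝ (Fin n) → ℝ}

lemma integral_linear_combination (a b c : ℝ) (hf : Integrable f) (hg : Integrable g)
    (hh : Integrable h) :
    Integrable (fun x => a * f x + b * g x + c * h x) ∧
      ∫ x, (a * f x + b * g x + c * h x) =
        a * (∫ x, f x) + b * (∫ x, g x) + c * ∫ x, h x := by
  have hab : Integrable fun x => a * f x + b * g x := (hf.const_mul a).add (hg.const_mul b)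
  refine ⟨hab.add (hh.const_mul c), ?_⟩
  rw [← integral_const_mul, ← integral_const_mul, ← integral_const_mul,
    ← integral_add (hf.const_mul a) (hg.const_mul b), ← integral_add hab (hh.const_mul c)]

lemma hasCompactSupport_mul_pow {k : ℕ} (hk : k ≠ 0) (hc : HasCompactSupport φ)
    (f : EuclideanSpace ℝ (Fin n) → ℝ) : HasCompactSupport (fun x => f x * φ x ^ k) :=
  HasCompactSupport.mul_left (f := f)
    (hc.comp_left (g := fun t : ℝ => t ^ k) (zero_pow hk))

lemma hasCompactSupport_sq (hc : HasCompactSupport f) : HasCompactSupport (fun x => f x ^ 2) :=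
  hc.comp_left (g := fun t : ℝ => t ^ 2) (zero_pow two_ne_zero)

lemma lap_mul_pow (k : ℕ) (hu : ContDiff ℝ 2 u) (hφ : ContDiff ℝ 2 φ) :
    lap (fun x => u x * φ x ^ (k + 2)) = fun x =>
      lap u x * φ x ^ (k + 2)
        + 2 * ((k + 2) * φ x ^ (k + 1) * ∑ i, pd i u x * pd i φ x)
        + u x * ((k + 2) * (k + 1) * φ x ^ k * ∑ i, pd i φ x ^ 2
          + (k + 2) * φ x ^ (k + 1) * lap φ x) := by
  rw [lap_mul hu (hφ.pow _), lap_pow k hφ]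
  funext x
  have : ∑ i, pd i u x * pd i (fun x => φ x ^ (k + 2)) x =
      (k + 2) * φ x ^ (k + 1) * ∑ i, pd i u x * pd i φ x := by
    rw [Finset.mul_sum]
    refine Finset.sum_congr rfl fun i _ => ?_
    rw [pd_pow (k + 1) (hφ.differentiable two_ne_zero)]
    push_cast
    ring
  rw [this]
  ring

lemma sq_sum_pd_mul_le (x : EuclideanSpace ℝ (Fin n)) {A s : ℝ}
    (hA : ∑ i, pd i φ x ^ 2 ≤ A * s ^ 2) :
    (∑ i, pd i u x * pd i φ x) ^ 2 ≤ (∑ i, pd i u x ^ 2) * (A * s ^ 2) :=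
  (Finset.sum_mul_sq_le_sq_mul_sq _ _ _).trans
    (mul_le_mul_of_nonneg_left hA (Finset.sum_nonneg fun _ _ => sq_nonneg _))

lemma abs_mul_lap_pow_le {A s t v H d : ℝ} (k : ℕ) (ht : 0 ≤ t) (ht1 : t ≤ 1) (hv : 0 ≤ v)
    (hH0 : 0 ≤ H) (hH : H ≤ A * s ^ 2) (hd : |d| ≤ A * s ^ 2) :
    |v * ((k + 2) * (k + 1) * t ^ k * H + (k + 2) * t ^ (k + 1) * d)| ≤
      (k + 2) ^ 2 * A * (s ^ 2 * v * t ^ k) := by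
  have hAs : 0 ≤ A * s ^ 2 := hH0.trans hH
  have h1 : |t * d| ≤ A * s ^ 2 := by
    rw [abs_mul, abs_of_nonneg ht]
    nlinarith [abs_nonneg d]
  have h2 : |(k + 1) * H + t * d| ≤ (k + 2) * (A * s ^ 2) := by
    refine (abs_add_le _ _).trans ?_
    rw [abs_of_nonneg (by positivity)]
    nlinarith [(Nat.cast_nonneg k : (0 : ℝ) ≤ k)]
  have e : v * ((k + 2) * (k + 1) * t ^ k * H + (k + 2) * t ^ (k + 1) * d) =
      (v * (k + 2) * t ^ k) * ((k + 1) * H + t * d) := by ring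
  rw [e, abs_mul, abs_of_nonneg (by positivity : 0 ≤ v * (k + 2) * t ^ k)]
  refine (mul_le_mul_of_nonneg_left h2 (by positivity)).trans_eq ?_
  ring

lemma abs_mul_gradient_pow_le {A s t v w H : ℝ} (k : ℕ) (ht : 0 ≤ t) (hv : 0 ≤ v)
    (hH0 : 0 ≤ H) (hH : H ≤ A * s ^ 2) :
    |v * w * ((k + 2) ^ 2 * t ^ (2 * k + 2) * H)| ≤
      (k + 2) ^ 2 * A * (|w * t ^ (k + 2)| * (s ^ 2 * v * t ^ k)) := by
  have e : v * w * ((k + 2) ^ 2 * t ^ (2 * k + 2) * H) =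
      (w * t ^ (k + 2)) * (v * t ^ k * (k + 2) ^ 2 * H) := by ring
  rw [e, abs_mul, abs_of_nonneg (by positivity : 0 ≤ v * t ^ k * (k + 2) ^ 2 * H)]
  have : v * t ^ k * (k + 2) ^ 2 * H ≤ v * t ^ k * (k + 2) ^ 2 * (A * s ^ 2) := by gcongr
  refine (mul_le_mul_of_nonneg_left this (abs_nonneg _)).trans_eq ?_
  ring

/-- Integration by parts for the weighted Dirichlet energy. -/
lemma integral_dirichlet_pow (k : ℕ) (s : ℝ) (hu : ContDiff ℝ 2 u) (hφ : ContDiff ℝ 2 φ)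
    (hc : HasCompactSupport φ) :
    (Integrable fun x => s ^ 2 * (∑ i, pd i u x ^ 2) * φ x ^ (2 * k + 2)
      + lap u x * φ x ^ (k + 2) * (s ^ 2 * u x * φ x ^ k)
      + s ^ 2 * u x * φ x ^ k * ((2 * k + 2) * φ x ^ (k + 1) * ∑ i, pd i u x * pd i φ x)) ∧
    ∫ x, (s ^ 2 * (∑ i, pd i u x ^ 2) * φ x ^ (2 * k + 2)
      + lap u x * φ x ^ (k + 2) * (s ^ 2 * u x * φ x ^ k)
      + s ^ 2 * u x * φ x ^ k * ((2 * k + 2) * φ x ^ (k + 1) * ∑ i, pd i u x * pd i φ x)) = 0 := by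
  have hu0 := hu.differentiable two_ne_zero
  have hφ0 := hφ.differentiable two_ne_zero
  have hu1 (i) : ContDiff ℝ 1 (pd i u) := pd_contDiff hu (by norm_num)
  have hF (i) : ContDiff ℝ 1 (fun x => s ^ 2 * (u x * pd i u x) * φ x ^ (2 * k + 1 + 1)) :=
    (contDiff_const.mul ((hu.of_le one_le_two).mul (hu1 i))).mul ((hφ.of_le one_le_two).pow _)
  have hFc (i) : HasCompactSupport (fun x => s ^ 2 * (u x * pd i u x) * φ x ^ (2 * k + 1 + 1)) :=
    hasCompactSupport_mul_pow (by omega) hc _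
  have hI (i) : Integrable
      (pd i (fun x => s ^ 2 * (u x * pd i u x) * φ x ^ (2 * k + 1 + 1))) :=
    (pd_contDiff (k := 0) (hF i) (by norm_num)).continuous.integrable_of_hasCompactSupport
      (pd_hasCompactSupport (hFc i))
  have key : ∫ x, ∑ i, pd i (fun x => s ^ 2 * (u x * pd i u x) * φ x ^ (2 * k + 1 + 1)) x = 0 := by
    rw [integral_finsetSum _ fun i _ => hI i]
    exact Finset.sum_eq_zero fun i _ => integral_pd_eq_zero (hF i) (hFc i)
  have e : (fun x => ∑ i, pd i (fun x => s ^ 2 * (u x * pd i u x) * φ x ^ (2 * k + 1 + 1)) x) =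
      fun x => s ^ 2 * (∑ i, pd i u x ^ 2) * φ x ^ (2 * k + 2)
      + lap u x * φ x ^ (k + 2) * (s ^ 2 * u x * φ x ^ k)
      + s ^ 2 * u x * φ x ^ k *
        ((2 * k + 2) * φ x ^ (k + 1) * ∑ i, pd i u x * pd i φ x) := by
    funext x
    rw [lap_eq_sum_pd hu]
    simp only [Finset.mul_sum, Finset.sum_mul]
    rw [← Finset.sum_add_distrib, ← Finset.sum_add_distrib]
    refine Finset.sum_congr rfl fun i _ => ?_
    have hu1' := (hu1 i).differentiable one_ne_zero
    rw [pd_mul ((hu0.fun_mul hu1').const_mul _) (hφ0.fun_pow _),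
      pd_const_mul _ (hu0.fun_mul hu1'), pd_mul hu0 hu1', pd_pow _ hφ0]
    push_cast
    ring
  rw [← e]
  exact ⟨integrable_finsetSum _ fun i _ => hI i, key⟩

lemma sq_gradient_term_le {A s t S G : ℝ} (k : ℕ) (hS : S ^ 2 ≤ G * (A * s ^ 2)) :
    ((k + 2) * t ^ (k + 1) * S) ^ 2 ≤ (k + 2) ^ 2 * A * (s ^ 2 * G * t ^ (2 * k + 2)) := by
  have := mul_le_mul_of_nonneg_left hS (sq_nonneg ((k + 2) * t ^ (k + 1)))
  calc _ = ((k + 2) * t ^ (k + 1)) ^ 2 * S ^ 2 := by ring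
    _ ≤ _ := this
    _ = _ := by ring

/-- The energy estimate for stable solutions: the nonlinear energy is controlled by the weighted
`L²` norm. The constant only depends on the exponents and on the derivative bounds for `φ`. -/
theorem exists_energy_le {p A : ℝ} {k : ℕ} (hp : 1 < p) (hA : 0 < A) (hk : k ≠ 0) :
    ∃ K : ℝ, 0 < K ∧ ∀ (s : ℝ) (u φ : EuclideanSpace ℝ (Fin n) → ℝ), ContDiff ℝ 4 u →
      (∀ x, 0 < u x) → (∀ x, lap (lap u) x = u x ^ p) →
      (∀ f, ContDiff ℝ 2 f → HasCompactSupport f →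
        p * ∫ x, u x ^ (p - 1) * f x ^ 2 ≤ ∫ x, (lap f x) ^ 2) →
      ContDiff ℝ 2 φ → HasCompactSupport φ → (∀ x, 0 ≤ φ x) → (∀ x, φ x ≤ 1) →
      (∀ x, ∑ i, pd i φ x ^ 2 ≤ A * s ^ 2) → (∀ x, |lap φ x| ≤ A * s ^ 2) →
      ∫ x, u x ^ (p - 1) * (u x * φ x ^ (k + 2)) ^ 2 ≤
        K * ∫ x, (s ^ 2 * u x * φ x ^ k) ^ 2 := by
  have hB : 0 < ((k : ℝ) + 2) ^ 2 * A := by positivity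
  obtain ⟨K, hK, hKabs⟩ := exists_energy_absorption hp hB
  refine ⟨K, hK, fun s u φ hu hpos heq hstab hφ hc hφ0 hφ1 hgrad hlap => ?_⟩
  set B : ℝ := ((k : ℝ) + 2) ^ 2 * A with hBdef
  have hu2 : ContDiff ℝ 2 u := hu.of_le (by norm_num)
  have hw : ContDiff ℝ 2 (lap u) := lap_contDiff hu (by norm_num)
  have hwc : Continuous (lap u) := hw.continuous
  have hGc : Continuous fun x => ∑ i, pd i u x ^ 2 :=
    continuous_finsetSum _ fun i _ =>
      ((pd_contDiff (k := 1) hu2 (by norm_num)).continuous.pow 2)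
  have hφc := hφ.continuous
  have huc := hu.continuous
  have ha : Integrable fun x => (lap u x * φ x ^ (k + 2)) ^ 2 :=
    (by fun_prop : Continuous fun x => (lap u x * φ x ^ (k + 2)) ^ 2).integrable_of_hasCompactSupport
      (hasCompactSupport_sq (hasCompactSupport_mul_pow (by omega) hc _))
  have hb : Integrable fun x => s ^ 2 * (∑ i, pd i u x ^ 2) * φ x ^ (2 * k + 2) :=
    ((continuous_const.mul hGc).mul (hφc.pow _)).integrable_of_hasCompactSupport
      (hasCompactSupport_mul_pow (by omega) hc _)
  have hcc : Integrable fun x => (s ^ 2 * u x * φ x ^ k) ^ 2 :=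
    (by fun_prop : Continuous fun x => (s ^ 2 * u x * φ x ^ k) ^ 2).integrable_of_hasCompactSupport
      (hasCompactSupport_sq (hasCompactSupport_mul_pow hk hc _))
  have hv : ContDiff ℝ 2 fun x => u x * φ x ^ (k + 2) := hu2.mul (hφ.pow _)
  have hvc : HasCompactSupport fun x => u x * φ x ^ (k + 2) :=
    hasCompactSupport_mul_pow (by omega) hc _
  have hz : ContDiff ℝ 2 fun x => u x * φ x ^ (2 * k + 2 + 2) := hu2.mul (hφ.pow _)
  have hzc : HasCompactSupport fun x => u x * φ x ^ (2 * k + 2 + 2) :=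
    hasCompactSupport_mul_pow (by omega) hc _
  set X := ∫ x, u x ^ (p - 1) * (u x * φ x ^ (k + 2)) ^ 2 with hX
  have hXeq : X = ∫ x, lap u x * lap (fun x => u x * φ x ^ (2 * k + 2 + 2)) x := by
    rw [← integral_lap_mul hw hz hzc, hX]
    congr 1
    funext x
    have : u x ^ p = u x ^ (p - 1) * u x := by
      rw [← rpow_add_one (hpos x).ne', sub_add_cancel]
    rw [heq, this]
    ring
  have hi1 : Integrable fun x => (lap (fun x => u x * φ x ^ (k + 2)) x) ^ 2 :=
    ((lap_contDiff (k := 0) hv (by norm_num)).continuous.pow 2).integrable_of_hasCompactSupport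
      (hasCompactSupport_sq (lap_hasCompactSupport hv hvc))
  have hi2 : Integrable fun x => lap u x * lap (fun x => u x * φ x ^ (2 * k + 2 + 2)) x :=
    (hwc.mul (lap_contDiff (k := 0) hz (by norm_num)).continuous).integrable_of_hasCompactSupport
      (lap_hasCompactSupport hz hzc).mul_left
  have hH0 (x) : 0 ≤ ∑ i, pd i φ x ^ 2 := Finset.sum_nonneg fun _ _ => sq_nonneg _
  have hTle (x) := sq_gradient_term_le (t := φ x) k (sq_sum_pd_mul_le (u := u) x (hgrad x))
  have hQle (x) := abs_mul_lap_pow_le k (hφ0 x) (hφ1 x) (hpos x).le (hH0 x) (hgrad x) (hlap x)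
  have hPle (x) := abs_mul_gradient_pow_le (w := lap u x) k (hφ0 x) (hpos x).le (hH0 x) (hgrad x)
  refine hKabs X (∫ x, (lap u x * φ x ^ (k + 2)) ^ 2)
    (∫ x, s ^ 2 * (∑ i, pd i u x ^ 2) * φ x ^ (2 * k + 2)) _
    (integral_nonneg fun _ => sq_nonneg _) (integral_nonneg fun _ => sq_nonneg _)
    (fun ε hε => ?_) ?_ (fun ε hε => ?_)
  · obtain ⟨hi, he⟩ := integral_linear_combination ε (8 * B) (2 * B ^ 2 + B ^ 2 / ε) ha hb hcc
    have hst := hstab _ hv hvc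
    have : (p - 1) * X ≤ ∫ x, ((lap (fun x => u x * φ x ^ (k + 2)) x) ^ 2
        - lap u x * lap (fun x => u x * φ x ^ (2 * k + 2 + 2)) x) := by
      rw [integral_sub hi1 hi2, ← hXeq]
      linarith
    rw [← he]
    refine this.trans (integral_mono (hi1.sub hi2) hi fun x => ?_)
    refine le_trans (le_of_eq ?_) (sq_sub_two_mul_le hε (hTle x) (hQle x) (hPle x))
    simp only [lap_mul_pow _ hu2 hφ]
    push_cast
    ring
  · obtain ⟨hi, he⟩ := integral_linear_combination (1 / 2) (-(32 * B)) (-(16 * B ^ 2)) ha hb hcc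
    rw [← he, hXeq]
    refine integral_mono hi hi2 fun x => ?_
    refine (half_sq_sub_le (hTle x) (hQle x) (hPle x)).trans (le_of_eq ?_)
    simp only [lap_mul_pow _ hu2 hφ]
    push_cast
    ring
  · obtain ⟨hi, he⟩ := integral_linear_combination (-ε) (1 / 2) (-(1 / (4 * ε) + 2 * B)) ha hb hcc
    obtain ⟨hi3, he3⟩ := integral_dirichlet_pow k s hu2 hφ hc
    rw [← he, ← he3]
    refine integral_mono hi hi3 fun x => half_sub_le hε hB ?_
    have h1 := hTle x
    have h2 : ((2 * k + 2) * φ x ^ (k + 1) * ∑ i, pd i u x * pd i φ x) ^ 2 ≤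
        4 * ((k + 2) * φ x ^ (k + 1) * ∑ i, pd i u x * pd i φ x) ^ 2 := by
      have e1 : ((2 * k + 2) * φ x ^ (k + 1) * ∑ i, pd i u x * pd i φ x) ^ 2 =
        (2 * k + 2 : ℝ) ^ 2 * (φ x ^ (k + 1) * ∑ i, pd i u x * pd i φ x) ^ 2 := by ring
      have e2 : 4 * ((k + 2) * φ x ^ (k + 1) * ∑ i, pd i u x * pd i φ x) ^ 2 =
        (2 * k + 4 : ℝ) ^ 2 * (φ x ^ (k + 1) * ∑ i, pd i u x * pd i φ x) ^ 2 := by ring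
      rw [e1, e2]
      gcongr
      norm_num
    rw [← hBdef] at h1
    linarith

end EnergyEstimate

section Cutoff

variable {n : ℕ}

lemma lap_comp_smul {f : EuclideanSpace ℝ (Fin n) → ℝ} (c : ℝ) (hf : ContDiff ℝ 2 f) :
    lap (fun x => f (c • x)) = fun x => c ^ 2 * lap f (c • x) := by
  have hfc : ContDiff ℝ 2 fun x => f (c • x) := hf.comp (contDiff_const_smul c)
  rw [lap_eq_sum_pd hfc, lap_eq_sum_pd hf]
  funext x
  rw [Finset.mul_sum]
  refine Finset.sum_congr rfl fun i _ => ?_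
  have h1 : Differentiable ℝ fun x => pd i f (c • x) :=
    ((pd_contDiff (k := 1) hf (by norm_num)).comp (contDiff_const_smul c)).differentiable
      one_ne_zero
  rw [pd_comp_smul, pd_const_mul _ h1, pd_comp_smul]
  ring

/-- Rescaled cutoff functions with scale-invariant derivative bounds. -/
lemma exists_cutoff (n : ℕ) : ∃ A : ℝ, 0 < A ∧ ∀ R : ℝ, 0 < R →
    ∃ φ : EuclideanSpace ℝ (Fin n) → ℝ, ContDiff ℝ 2 φ ∧ HasCompactSupport φ ∧
      (∀ x, 0 ≤ φ x) ∧ (∀ x, φ x ≤ 1) ∧ (∀ x ∈ Metric.ball 0 (2 * R), φ x = 1) ∧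
      (∀ x ∉ Metric.ball 0 (R * 4), φ x = 0) ∧
      (∀ x, ∑ i, pd i φ x ^ 2 ≤ A * R⁻¹ ^ 2) ∧ ∀ x, |lap φ x| ≤ A * R⁻¹ ^ 2 := by
  let ψ : ContDiffBump (0 : EuclideanSpace ℝ (Fin n)) := ⟨2, 4, by norm_num, by norm_num⟩
  have hψ : ContDiff ℝ 2 ψ := ψ.contDiff
  have hψc : HasCompactSupport ψ := ψ.hasCompactSupport
  have hpd (i) : ∃ C, ∀ x, ‖pd i ψ x‖ ≤ C :=
    (pd_hasCompactSupport hψc).exists_bound_of_continuous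
      (pd_contDiff (k := 1) hψ (by norm_num)).continuous
  choose C hC using hpd
  obtain ⟨D, hD⟩ := (lap_hasCompactSupport hψ hψc).exists_bound_of_continuous
    (lap_contDiff (k := 0) hψ (by norm_num)).continuous
  have hD0 : 0 ≤ D := (norm_nonneg _).trans (hD 0)
  have hC0 : 0 ≤ ∑ i, C i ^ 2 := Finset.sum_nonneg fun _ _ => sq_nonneg _
  refine ⟨∑ i, C i ^ 2 + D + 1, by positivity, fun R hR => ⟨fun x => ψ (R⁻¹ • x),
    hψ.comp (contDiff_const_smul _), hψc.comp_smul (inv_ne_zero hR.ne'), fun x => ψ.nonneg,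
    fun x => ψ.le_one, fun x hx => ?_, fun x hx => ?_, fun x => ?_, fun x => ?_⟩⟩
  · refine ψ.one_of_mem_closedBall ?_
    rw [mem_ball_zero_iff] at hx
    rw [mem_closedBall_zero_iff, norm_smul, norm_inv, Real.norm_of_nonneg hR.le,
      inv_mul_le_iff₀ hR, mul_comm]
    exact hx.le
  · refine ψ.zero_of_le_dist ?_
    rw [mem_ball_zero_iff, not_lt] at hx
    rw [dist_zero_right, norm_smul, norm_inv, Real.norm_of_nonneg hR.le, le_inv_mul_iff₀ hR]
    exact hx
  · have h : ∑ i, pd i (fun x => ψ (R⁻¹ • x)) x ^ 2 ≤ ∑ i, C i ^ 2 * R⁻¹ ^ 2 := by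
      refine Finset.sum_le_sum fun i _ => ?_
      rw [pd_comp_smul, mul_pow, mul_comm]
      refine mul_le_mul_of_nonneg_right ?_ (sq_nonneg _)
      rw [← sq_abs]
      exact pow_le_pow_left₀ (abs_nonneg _) (hC i _) 2
    refine h.trans ?_
    rw [← Finset.sum_mul]
    gcongr
    linarith
  · rw [lap_comp_smul _ hψ, abs_mul, abs_of_nonneg (sq_nonneg _), mul_comm]
    gcongr
    have := hD (R⁻¹ • x)
    rw [Real.norm_eq_abs] at this
    linarith

end Cutoff

theorem stmt_13 (n : ℕ) (p : ℝ) (hp : 1 < p)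
    (u : EuclideanSpace ℝ (Fin n) → ℝ) (hreg : ContDiff ℝ 4 u)
    (hpos : ∀ x, 0 < u x) (heq : ∀ x, lap (lap u) x = u x ^ p)
    (hstab : ∀ φ : EuclideanSpace ℝ (Fin n) → ℝ, ContDiff ℝ (⊤ : ℕ∞) φ →
      HasCompactSupport φ →
      p * ∫ x, u x ^ (p - 1) * φ x ^ 2 ≤ ∫ x, (lap φ x) ^ 2) :
    ∃ C : ℝ, 0 < C ∧ ∀ R : ℝ, 1 ≤ R →
      ∫ x in Metric.ball (0 : EuclideanSpace ℝ (Fin n)) (2*R), u x ^ 2 ≤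
        C * R ^ ((n : ℝ) - 8/(p-1)) := by
  have hp' : 0 < p - 1 := by linarith
  obtain ⟨k, hk⟩ := exists_nat_ge (4 / (p - 1))
  have hk0 : k ≠ 0 := by
    rintro rfl
    have : 0 < 4 / (p - 1) := by positivity
    rw [Nat.cast_zero] at hk
    linarith
  obtain ⟨A, hA, hcut⟩ := exists_cutoff n
  obtain ⟨K, hK, hKle⟩ := exists_energy_le (n := n) hp hA hk0
  set α := (p + 1) / (p - 1) with hα
  set V := volume.real (Metric.ball (0 : EuclideanSpace ℝ (Fin n)) 4)
  have hV0 : 0 < V :=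
    ENNReal.toReal_pos (Metric.measure_ball_pos volume _ (by norm_num)).ne' measure_ball_lt_top.ne
  refine ⟨(2 * K) ^ α * V / K, by positivity, fun R hR => ?_⟩
  have hR0 : 0 < R := by linarith
  obtain ⟨φ, hφ, hc, hφ0, hφ1, hone, hzero, hgrad, hlap⟩ := hcut R hR0
  have huc := hreg.continuous
  have hφc := hφ.continuous
  have hwc : Continuous fun x => u x ^ (p - 1) :=
    huc.rpow_const fun x => Or.inl (hpos x).ne'
  have hE := hKle R⁻¹ u φ hreg hpos heq
    (fun f hf hfc => stability_of_contDiff_two hwc hstab hf hfc) hφ hc hφ0 hφ1 hgrad hlap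
  set I := ∫ x, (R⁻¹ ^ 2 * u x * φ x ^ k) ^ 2
  have hIi : Integrable fun x => (R⁻¹ ^ 2 * u x * φ x ^ k) ^ 2 :=
    (by fun_prop : Continuous fun x =>
        (R⁻¹ ^ 2 * u x * φ x ^ k) ^ 2).integrable_of_hasCompactSupport
      (hasCompactSupport_sq (hasCompactSupport_mul_pow hk0 hc _))
  have hXi : Integrable fun x => u x ^ (p - 1) * (u x * φ x ^ (k + 2)) ^ 2 :=
    (by fun_prop : Continuous fun x =>
        u x ^ (p - 1) * (u x * φ x ^ (k + 2)) ^ 2).integrable_of_hasCompactSupport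
      (hasCompactSupport_sq (hasCompactSupport_mul_pow (by omega) hc _)).mul_left
  set q := 2 * K * R⁻¹ ^ 4 with hq
  have hq0 : 0 < q := by positivity
  have hball : volume.real (Metric.ball (0 : EuclideanSpace ℝ (Fin n)) (R * 4)) = R ^ n * V := by
    rw [measureReal_def, Measure.addHaar_ball_mul_of_pos _ _ hR0, ENNReal.toReal_mul,
      ENNReal.toReal_ofReal (by positivity), finrank_euclideanSpace_fin]
    rfl
  have hqi : Integrable ((Metric.ball (0 : EuclideanSpace ℝ (Fin n)) (R * 4)).indicator
      fun _ => q ^ α) := by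
    rw [integrable_indicator_iff measurableSet_ball]
    exact integrableOn_const measure_ball_lt_top.ne
  have hyoung : 2 * K * I ≤ K * I + R ^ n * V * q ^ α := by
    calc 2 * K * I = ∫ x, 2 * K * (R⁻¹ ^ 2 * u x * φ x ^ k) ^ 2 := by rw [integral_const_mul]
      _ ≤ ∫ x, (u x ^ (p - 1) * (u x * φ x ^ (k + 2)) ^ 2
          + (Metric.ball (0 : EuclideanSpace ℝ (Fin n)) (R * 4)).indicator
            (fun _ => q ^ α) x) := by
        refine integral_mono (hIi.const_mul _) (hXi.add hqi) fun x => ?_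
        by_cases hx : x ∈ Metric.ball (0 : EuclideanSpace ℝ (Fin n)) (R * 4)
        · simp only [Set.indicator_of_mem hx]
          refine le_trans (le_of_eq ?_)
            (mul_sq_mul_pow_le_add_rpow hp hq0 (hpos x) (hφ0 x) (hφ1 x) hk)
          rw [hq]
          ring
        · simp [hzero x hx, hk0, Set.indicator_of_notMem hx]
      _ ≤ K * I + R ^ n * V * q ^ α := by
        rw [integral_add hXi hqi, integral_indicator_const _ measurableSet_ball, hball, smul_eq_mul]
        linarith
  have hIle : I ≤ R ^ n * V * q ^ α / K := by
    rw [le_div_iff₀ hK]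
    linarith
  have hmain : ∫ x in Metric.ball (0 : EuclideanSpace ℝ (Fin n)) (2 * R), u x ^ 2 ≤ R ^ 4 * I := by
    calc _ = ∫ x in Metric.ball (0 : EuclideanSpace ℝ (Fin n)) (2 * R),
          R ^ 4 * (R⁻¹ ^ 2 * u x * φ x ^ k) ^ 2 := by
          refine setIntegral_congr_fun measurableSet_ball fun x hx => ?_
          simp only [hone x hx, one_pow, mul_one]
          field_simp
      _ ≤ ∫ x, R ^ 4 * (R⁻¹ ^ 2 * u x * φ x ^ k) ^ 2 :=
          setIntegral_le_integral (hIi.const_mul _)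
            (Filter.Eventually.of_forall fun x => by positivity)
      _ = R ^ 4 * I := integral_const_mul _ _
  refine hmain.trans ((mul_le_mul_of_nonneg_left hIle (by positivity)).trans_eq ?_)
  have hqα : q ^ α = (2 * K) ^ α * R ^ (-(4 * α)) := by
    rw [hq, mul_rpow (by positivity) (by positivity), inv_pow, ← rpow_natCast R 4,
      ← rpow_neg hR0.le, ← rpow_mul hR0.le]
    congr 2
    push_cast
    ring
  have hexp : R ^ ((n : ℝ) - 8 / (p - 1)) = R ^ 4 * R ^ n * R ^ (-(4 * α)) := by
    rw [← rpow_natCast R 4, ← rpow_natCast R n, ← rpow_add hR0, ← rpow_add hR0]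
    congr 1
    rw [hα]
    push_cast
    field_simp
    ring
  rw [hqα, hexp]
  ring
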